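/- Let G=(V,E) be a finite simple undirected graph with preferences as described, assume P≠∅, and let x∈P. Let e={v,w} be an edge in E⁺. Then W_x(v) ≻_v e if and only if e ≻_w B_x(w). -/

import Mathlib

/-!
Common setup: a finite simple undirected graph `G = (V, E)` where edges are
elements of `Sym2 V`, together with, for each vertex `v`, a complete and
transitive preference relation `pref v` on `E(v) ∪ {∅}` (the unmatched
option `∅` is encoded as `none : Option (Sym2 V)`), where every incident
edge is strictly preferred to `∅`.
-/

/-- A roommates instance: a finite simple graph with preferences. -/
structure RSetup (V : Type*) [Fintype V] [DecidableEq V] where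
  /-- the edge set -/
  E : Finset (Sym2 V)
  /-- the graph is simple: no loops -/
  not_diag : ∀ e ∈ E, ¬ e.IsDiag
  /-- the preference relation `≿ᵥ` of each vertex, on `E(v) ∪ {∅}` -/
  pref : V → Option (Sym2 V) → Option (Sym2 V) → Prop
  /-- completeness of `≿ᵥ` on `E(v) ∪ {∅}` -/
  pref_total : ∀ v : V, ∀ a b : Option (Sym2 V),
    (∀ e, a = some e → e ∈ E ∧ v ∈ e) → (∀ e, b = some e → e ∈ E ∧ v ∈ e) →
    pref v a b ∨ pref v b a
  /-- transitivity of `≿ᵥ` on `E(v) ∪ {∅}` -/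
  pref_trans : ∀ v : V, ∀ a b c : Option (Sym2 V),
    (∀ e, a = some e → e ∈ E ∧ v ∈ e) → (∀ e, b = some e → e ∈ E ∧ v ∈ e) →
    (∀ e, c = some e → e ∈ E ∧ v ∈ e) →
    pref v a b → pref v b c → pref v a c
  /-- every incident edge is strictly preferred to being unmatched -/
  pref_none : ∀ v : V, ∀ e ∈ E, v ∈ e →
    pref v (some e) none ∧ ¬ pref v none (some e)

namespace RSetup

variable {V : Type*} [Fintype V] [DecidableEq V] (S : RSetup V)

/-- `a ≻ᵥ b` : strict preference. -/
def SPref (v : V) (a b : Option (Sym2 V)) : Prop :=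
  S.pref v a b ∧ ¬ S.pref v b a

/-- `a ∼ᵥ b` : indifference. -/
def IPref (v : V) (a b : Option (Sym2 V)) : Prop :=
  S.pref v a b ∧ S.pref v b a

/-- `F(v)` : the set of edges in `F` incident to `v`. -/
def inc (F : Finset (Sym2 V)) (v : V) : Finset (Sym2 V) :=
  F.filter (fun e => v ∈ e)

/-- a matching in `G` -/
def IsMatching (μ : Finset (Sym2 V)) : Prop :=
  μ ⊆ S.E ∧ ∀ v : V, (inc μ v).card ≤ 1

/-- `μ(v)` : the edge of `μ` incident to `v` (or `none`). -/
noncomputable def matchOf (μ : Finset (Sym2 V)) (v : V) : Option (Sym2 V) :=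
  (inc μ v).toList.head?

/-- `e` blocks the matching `μ`. -/
def Blocks (μ : Finset (Sym2 V)) (e : Sym2 V) : Prop :=
  e ∈ S.E ∧ e ∉ μ ∧ (∀ v ∈ e, S.pref v (some e) (matchOf μ v)) ∧
    (∃ v ∈ e, S.SPref v (some e) (matchOf μ v))

/-- a strongly stable matching in `G` -/
def StronglyStable (μ : Finset (Sym2 V)) : Prop :=
  S.IsMatching μ ∧ ∀ e : Sym2 V, ¬ S.Blocks μ e

/-- `x(W) = ∑_{e ∈ W} x(e)` -/
def xS (x : Sym2 V → ℝ) (W : Finset (Sym2 V)) : ℝ := ∑ e ∈ W, x e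

/-- `x ∈ ℝ₊^E`, encoded as a nonnegative function on `Sym2 V` vanishing
outside `E`. -/
def IsVec (x : Sym2 V → ℝ) : Prop :=
  (∀ e, 0 ≤ x e) ∧ ∀ e ∉ S.E, x e = 0

open Classical in
/-- `E[∼ᵥ e] = {f ∈ E(v) : f ∼ᵥ e}` -/
noncomputable def simSet (v : V) (e : Sym2 V) : Finset (Sym2 V) :=
  (inc S.E v).filter (fun f => S.IPref v (some f) (some e))

open Classical in
/-- `E[≻ᵥ e] = {f ∈ E(v) : f ≻ᵥ e}` -/
noncomputable def succSet (v : V) (e : Sym2 V) : Finset (Sym2 V) :=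
  (inc S.E v).filter (fun f => S.SPref v (some f) (some e))

open Classical in
/-- `E⟨X⟩ = {e ∈ E : e ⊆ X}` -/
noncomputable def esub (X : Finset V) : Finset (Sym2 V) :=
  S.E.filter (fun e => ∀ u ∈ e, u ∈ X)

/-- constraint (1): `x(E(v)) ≤ 1` for every vertex `v` -/
def C1 (x : Sym2 V → ℝ) : Prop := ∀ v : V, xS x (inc S.E v) ≤ 1

/-- constraint (2): `x(E[∼ᵥ e]) + ∑_{w ∈ e} x(E[≻_w e]) ≥ 1`
for every edge `e ∈ E` and `v ∈ e` -/
def C2 (x : Sym2 V → ℝ) : Prop := ∀ v w : V, s(v, w) ∈ S.E →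
  xS x (S.simSet v s(v, w)) +
    (xS x (S.succSet v s(v, w)) + xS x (S.succSet w s(v, w))) ≥ 1

/-- constraint (3): `x(E⟨X⟩) ≤ ⌊|X|/2⌋` for every odd `X ⊆ V` -/
def C3 (x : Sym2 V → ℝ) : Prop := ∀ X : Finset V, Odd X.card →
  xS x (S.esub X) ≤ ((X.card / 2 : ℕ) : ℝ)

/-- membership in the polytope `P` -/
def memP (x : Sym2 V → ℝ) : Prop := S.IsVec x ∧ S.C1 x ∧ S.C2 x ∧ S.C3 x

/-- the characteristic vector `χ_μ` of a set of edges -/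
def chi (μ : Finset (Sym2 V)) : Sym2 V → ℝ := fun e => if e ∈ μ then 1 else 0

open Classical in
/-- `E_x = {e ∈ E : x(e) > 0}` -/
noncomputable def supp (x : Sym2 V → ℝ) : Finset (Sym2 V) :=
  S.E.filter (fun e => 0 < x e)

/-- `V₁` : the set of vertices `v` with `x(E(v)) > 0` for some `x ∈ P` -/
def V1 : Set V := {v : V | ∃ x : Sym2 V → ℝ, S.memP x ∧ 0 < xS x (inc S.E v)}

open Classical in
/-- `B_x(v)` : the best edges in `E_x(v)` for `v` -/
noncomputable def Bset (x : Sym2 V → ℝ) (v : V) : Finset (Sym2 V) :=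
  (inc (S.supp x) v).filter
    (fun e => ∀ f ∈ inc (S.supp x) v, S.pref v (some e) (some f))

open Classical in
/-- `W_x(v)` : the worst edges in `E_x(v)` for `v` -/
noncomputable def Wset (x : Sym2 V → ℝ) (v : V) : Finset (Sym2 V) :=
  (inc (S.supp x) v).filter
    (fun e => ∀ f ∈ inc (S.supp x) v, S.pref v (some f) (some e))

/-- a nonempty `F ⊆ E(v)` is flat if `v` is indifferent among its members -/
def Flat (v : V) (F : Finset (Sym2 V)) : Prop :=
  F.Nonempty ∧ ∀ e ∈ F, ∀ f ∈ F, S.IPref v (some e) (some f)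

open Classical in
/-- `T_x` : edges `e ∈ E⟨V₁⟩` such that, for each `v ∈ e`, either
`e ∈ B_x(v) ∪ W_x(v)` or `B_x(v) ≻ᵥ e ≻ᵥ W_x(v)`. -/
noncomputable def Tset (x : Sym2 V → ℝ) : Finset (Sym2 V) :=
  (S.E.filter (fun e => ∀ u ∈ e, u ∈ S.V1)).filter (fun e => ∀ v ∈ e,
    (e ∈ S.Bset x v ∪ S.Wset x v) ∨
      ((∀ f ∈ S.Bset x v, S.SPref v (some f) (some e)) ∧
        (∀ f ∈ S.Wset x v, S.SPref v (some e) (some f))))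

/-- membership in `P(F) = {x ∈ P : x(e) = 0 for all e ∈ E \ F}` -/
def memPF (F : Finset (Sym2 V)) (x : Sym2 V → ℝ) : Prop :=
  S.memP x ∧ ∀ e ∈ S.E, e ∉ F → x e = 0

open Classical in
/-- `E⁺ = {e ∈ E : e ∈ E_z for some z ∈ P}` -/
noncomputable def Eplus : Finset (Sym2 V) :=
  S.E.filter (fun e => ∃ z : Sym2 V → ℝ, S.memP z ∧ 0 < z e)

open Classical in
/-- `P'` : given `x ∈ P` and a strongly stable matching `σ`, the set of
vertices `v ∈ V₁` with `W_x(v) ≻ᵥ σ(v)`, or with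
`B_x(v) ≻ᵥ W_x(v)` and `W_x(v) ∼ᵥ σ(v)`. -/
def Pset (x : Sym2 V → ℝ) (σ : Finset (Sym2 V)) : Set V :=
  {v : V | v ∈ S.V1 ∧
    ((∀ f ∈ S.Wset x v, S.SPref v (some f) (matchOf σ v)) ∨
      ((∀ f ∈ S.Bset x v, ∀ g ∈ S.Wset x v, S.SPref v (some f) (some g)) ∧
        (∀ f ∈ S.Wset x v, S.IPref v (some f) (matchOf σ v))))}

/-- `Q'` : given `x ∈ P` and a strongly stable matching `σ`, the set of
vertices `v ∈ V₁` with `σ(v) ≻ᵥ B_x(v)`, or with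
`B_x(v) ≻ᵥ W_x(v)` and `B_x(v) ∼ᵥ σ(v)`. -/
def Qset (x : Sym2 V → ℝ) (σ : Finset (Sym2 V)) : Set V :=
  {v : V | v ∈ S.V1 ∧
    ((∀ f ∈ S.Bset x v, S.SPref v (matchOf σ v) (some f)) ∨
      ((∀ f ∈ S.Bset x v, ∀ g ∈ S.Wset x v, S.SPref v (some f) (some g)) ∧
        (∀ f ∈ S.Bset x v, S.IPref v (some f) (matchOf σ v))))}

/-- `R'` : given `x ∈ P` and a strongly stable matching `σ`, the set of
vertices `v ∈ V₁` such that `E_x(v)` is flat and `E_x(v) ∼ᵥ σ(v)`. -/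
def Rset (x : Sym2 V → ℝ) (σ : Finset (Sym2 V)) : Set V :=
  {v : V | v ∈ S.V1 ∧ S.Flat v (inc (S.supp x) v) ∧
    ∀ f ∈ inc (S.supp x) v, S.IPref v (some f) (matchOf σ v)}

end RSetup

namespace RSetup

lemma mem_inc_iff {V : Type*} [DecidableEq V] {F : Finset (Sym2 V)} {v : V} {e : Sym2 V} :
    e ∈ inc F v ↔ e ∈ F ∧ v ∈ e := by
  simp [inc]

/-- A nonempty finite set has a maximal element for any relation that is total and transitive on it. -/
lemma exists_forall_rel {α : Type*} (r : α → α → Prop) (s : Finset α) (hs : s.Nonempty)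
    (total : ∀ a ∈ s, ∀ b ∈ s, r a b ∨ r b a)
    (trans : ∀ a ∈ s, ∀ b ∈ s, ∀ c ∈ s, r a b → r b c → r a c) :
    ∃ a ∈ s, ∀ b ∈ s, r a b := by
  classical
  induction hs using Finset.Nonempty.cons_induction with
  | singleton a =>
    exact ⟨a, by simp, by simpa using total a (by simp) a (by simp)⟩
  | cons a s ha hs ih =>
    obtain ⟨m, hm, hmax⟩ := ih
      (fun b hb c hc => total b (by simp [hb]) c (by simp [hc]))
      (fun b hb c hc d hd => trans b (by simp [hb]) c (by simp [hc]) d (by simp [hd]))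
    have ha' : a ∈ Finset.cons a s ha := by simp
    have hm' : m ∈ Finset.cons a s ha := by simp [hm]
    rcases total a ha' m hm' with h | h
    · refine ⟨a, ha', fun b hb => ?_⟩
      rcases Finset.mem_cons.1 hb with rfl | hb'
      · simpa using total b hb b hb
      · exact trans a ha' m hm' b hb h (hmax b hb')
    · refine ⟨m, hm', fun b hb => ?_⟩
      rcases Finset.mem_cons.1 hb with rfl | hb'
      · exact h
      · exact hmax b hb'

variable {V : Type*} [Fintype V] [DecidableEq V] (S : RSetup V)

lemma pref_or {v : V} {e f : Sym2 V} (he : e ∈ inc S.E v) (hf : f ∈ inc S.E v) :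
    S.pref v (some e) (some f) ∨ S.pref v (some f) (some e) := by
  rw [mem_inc_iff] at he hf
  apply S.pref_total v <;> simpa using by assumption

lemma pref_trans_edge {v : V} {e f g : Sym2 V} (he : e ∈ inc S.E v) (hf : f ∈ inc S.E v)
    (hg : g ∈ inc S.E v) (hef : S.pref v (some e) (some f))
    (hfg : S.pref v (some f) (some g)) : S.pref v (some e) (some g) := by
  rw [mem_inc_iff] at he hf hg
  refine S.pref_trans v _ (some f) _ ?_ ?_ ?_ hef hfg <;> simpa using by assumption

lemma inc_supp_subset (x : Sym2 V → ℝ) (v : V) : inc (S.supp x) v ⊆ inc S.E v := by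
  intro e he
  simp only [supp, mem_inc_iff, Finset.mem_filter] at he ⊢
  exact ⟨he.1.1, he.2⟩

lemma exists_mem_Bset {x : Sym2 V → ℝ} {v : V} {f : Sym2 V} (hf : f ∈ inc (S.supp x) v) :
    ∃ g ∈ S.Bset x v, S.pref v (some g) (some f) := by
  have hsub := S.inc_supp_subset x v
  obtain ⟨g, hg, hmax⟩ := exists_forall_rel
    (fun a b => S.pref v (some a) (some b)) (inc (S.supp x) v) ⟨f, hf⟩
    (fun a ha b hb => S.pref_or (hsub ha) (hsub hb))
    (fun a ha b hb c hc => S.pref_trans_edge (hsub ha) (hsub hb) (hsub hc))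
  exact ⟨g, by simpa [Bset] using ⟨hg, hmax⟩, hmax f hf⟩

lemma exists_mem_Wset {x : Sym2 V → ℝ} {v : V} {f : Sym2 V} (hf : f ∈ inc (S.supp x) v) :
    ∃ g ∈ S.Wset x v, S.pref v (some f) (some g) := by
  have hsub := S.inc_supp_subset x v
  obtain ⟨g, hg, hmin⟩ := exists_forall_rel
    (fun a b => S.pref v (some b) (some a)) (inc (S.supp x) v) ⟨f, hf⟩
    (fun a ha b hb => S.pref_or (hsub hb) (hsub ha))
    (fun a ha b hb c hc hab hbc => S.pref_trans_edge (hsub hc) (hsub hb) (hsub ha) hbc hab)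
  exact ⟨g, by simpa [Wset] using ⟨hg, hmin⟩, hmin f hf⟩

lemma Bset_subset (x : Sym2 V → ℝ) (v : V) : S.Bset x v ⊆ inc (S.supp x) v := by
  classical exact Finset.filter_subset _ _

lemma Wset_subset (x : Sym2 V → ℝ) (v : V) : S.Wset x v ⊆ inc (S.supp x) v := by
  classical exact Finset.filter_subset _ _

/-- `W_x(v) ≻ᵥ e` says that every edge of `E_x(v)` is strictly better than `e`. -/
lemma forall_Wset_SPref_iff {x : Sym2 V → ℝ} {v : V} {e : Sym2 V} (he : e ∈ inc S.E v) :
    (∀ f ∈ S.Wset x v, S.SPref v (some f) (some e)) ↔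
      ∀ f ∈ inc (S.supp x) v, S.SPref v (some f) (some e) := by
  have hsub := S.inc_supp_subset x v
  refine ⟨fun h f hf => ?_, fun h f hf => h f (S.Wset_subset x v hf)⟩
  obtain ⟨g, hg, hfg⟩ := S.exists_mem_Wset hf
  have hgE := hsub (S.Wset_subset x v hg)
  obtain ⟨h1, h2⟩ := h g hg
  exact ⟨S.pref_trans_edge (hsub hf) hgE he hfg h1,
    fun h3 => h2 (S.pref_trans_edge he (hsub hf) hgE h3 hfg)⟩

/-- `e ≻ᵥ B_x(v)` says that `e` is strictly better than every edge of `E_x(v)`. -/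
lemma forall_SPref_Bset_iff {x : Sym2 V → ℝ} {v : V} {e : Sym2 V} (he : e ∈ inc S.E v) :
    (∀ f ∈ S.Bset x v, S.SPref v (some e) (some f)) ↔
      ∀ f ∈ inc (S.supp x) v, S.SPref v (some e) (some f) := by
  have hsub := S.inc_supp_subset x v
  refine ⟨fun h f hf => ?_, fun h f hf => h f (S.Bset_subset x v hf)⟩
  obtain ⟨g, hg, hgf⟩ := S.exists_mem_Bset hf
  have hgE := hsub (S.Bset_subset x v hg)
  obtain ⟨h1, h2⟩ := h g hg
  exact ⟨S.pref_trans_edge he hgE (hsub hf) h1 hgf,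
    fun h3 => h2 (S.pref_trans_edge hgE (hsub hf) he hgf h3)⟩

/-- `x(E[∼ᵥ e]) + 2 x(E[≻ᵥ e])` -/
noncomputable def weakLoad (x : Sym2 V → ℝ) (v : V) (e : Sym2 V) : ℝ :=
  xS x (S.simSet v e) + 2 * xS x (S.succSet v e)

lemma sum_mul_weakLoad_add (x z : Sym2 V → ℝ) (v : V) :
    ∑ e ∈ inc S.E v, z e * S.weakLoad x v e + ∑ e ∈ inc S.E v, x e * S.weakLoad z v e =
      2 * (xS z (inc S.E v) * xS x (inc S.E v)) := by
  classical
  let c : Sym2 V → Sym2 V → ℝ := fun f e =>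
    (if S.IPref v (some f) (some e) then 1 else 0) +
      2 * (if S.SPref v (some f) (some e) then 1 else 0)
  have hc : ∀ y : Sym2 V → ℝ, ∀ e, S.weakLoad y v e = ∑ f ∈ inc S.E v, y f * c f e := by
    intro y e
    simp only [weakLoad, xS, simSet, succSet, Finset.sum_filter, Finset.mul_sum,
      ← Finset.sum_add_distrib, c]
    refine Finset.sum_congr rfl fun f _ => ?_
    split_ifs <;> ring
  have hcc : ∀ e ∈ inc S.E v, ∀ f ∈ inc S.E v, c f e + c e f = 2 := by
    intro e he f hf
    by_cases h1 : S.pref v (some e) (some f)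
    · by_cases h2 : S.pref v (some f) (some e)
      · norm_num [c, IPref, SPref, h1, h2]
      · simp [c, IPref, SPref, h1, h2]
    · have h2 := (S.pref_or he hf).resolve_left h1
      simp [c, IPref, SPref, h1, h2]
  rw [xS, xS, Finset.sum_mul_sum]
  simp only [hc, Finset.mul_sum]
  have hswap : ∑ e ∈ inc S.E v, ∑ f ∈ inc S.E v, x e * (z f * c f e) =
      ∑ e ∈ inc S.E v, ∑ f ∈ inc S.E v, x f * (z e * c e f) := Finset.sum_comm
  simp only [hswap, ← Finset.sum_add_distrib]
  refine Finset.sum_congr rfl fun e he => Finset.sum_congr rfl fun f hf => ?_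
  linear_combination z e * x f * hcc e he f hf

lemma sum_sum_inc (φ : V → Sym2 V → ℝ) :
    ∑ u, ∑ e ∈ inc S.E u, φ u e = ∑ e ∈ S.E, ∑ u with u ∈ e, φ u e := by
  simp only [inc, Finset.sum_filter]
  exact Finset.sum_comm

lemma sum_endpoints {a b : V} (h : s(a, b) ∈ S.E) (φ : V → ℝ) :
    ∑ u with u ∈ s(a, b), φ u = φ a + φ b := by
  have hab : a ≠ b := by simpa using S.not_diag _ h
  rw [← Finset.sum_pair hab]
  congr 1
  ext u
  simp

lemma C2.swap {S : RSetup V} {x : Sym2 V → ℝ} (hx : S.C2 x) {v w : V} (h : s(v, w) ∈ S.E) :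
    xS x (S.simSet w s(v, w)) +
      (xS x (S.succSet v s(v, w)) + xS x (S.succSet w s(v, w))) ≥ 1 := by
  have := hx w v (by rwa [Sym2.eq_swap])
  rw [Sym2.eq_swap] at this
  linarith

lemma two_le_sum_weakLoad {x : Sym2 V → ℝ} (hx : S.C2 x) {e : Sym2 V} (he : e ∈ S.E) :
    2 ≤ ∑ u with u ∈ e, S.weakLoad x u e := by
  induction e with
  | h a b =>
    rw [S.sum_endpoints he]
    have := hx a b he
    have := hx.swap he
    simp only [weakLoad]
    linarith

lemma sum_mul_weakLoad_sub (x z : Sym2 V → ℝ) :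
    ∑ e ∈ S.E, z e * (∑ u with u ∈ e, S.weakLoad x u e - 2) =
      ∑ u, (∑ e ∈ inc S.E u, z e * S.weakLoad x u e - xS z (inc S.E u)) := by
  simp only [xS, ← Finset.sum_sub_distrib]
  rw [S.sum_sum_inc]
  refine Finset.sum_congr rfl fun e he => ?_
  induction e with
  | h a b =>
    rw [S.sum_endpoints he, S.sum_endpoints he]
    ring

lemma xS_nonneg {x : Sym2 V → ℝ} (hx : S.IsVec x) (W : Finset (Sym2 V)) : 0 ≤ xS x W :=
  Finset.sum_nonneg fun e _ => hx.1 e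

/-- Complementary slackness: for `x, z ∈ P`, every edge in the support of `z` is tight for `x`,
and every vertex is either saturated by both or by none of them. -/
lemma tight_of_memP {x z : Sym2 V → ℝ} (hx : S.memP x) (hz : S.memP z) :
    (∀ e ∈ S.E, 0 < z e → ∑ u with u ∈ e, S.weakLoad x u e = 2) ∧
      ∀ u, 2 * (xS z (inc S.E u) * xS x (inc S.E u)) =
        xS z (inc S.E u) + xS x (inc S.E u) := by
  have nonneg : ∀ y y' : Sym2 V → ℝ, S.memP y → S.memP y' →
      ∀ e ∈ S.E, 0 ≤ y' e * (∑ u with u ∈ e, S.weakLoad y u e - 2) :=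
    fun y y' hy hy' e he =>
      mul_nonneg (hy'.1.1 e) (by linarith [S.two_le_sum_weakLoad hy.2.2.1 he])
  have hzx := Finset.sum_nonneg (nonneg x z hx hz)
  have hxz := Finset.sum_nonneg (nonneg z x hz hx)
  have hsum : ∑ e ∈ S.E, z e * (∑ u with u ∈ e, S.weakLoad x u e - 2) +
      ∑ e ∈ S.E, x e * (∑ u with u ∈ e, S.weakLoad z u e - 2) =
      ∑ u, (2 * (xS z (inc S.E u) * xS x (inc S.E u)) -
        (xS z (inc S.E u) + xS x (inc S.E u))) := by
    rw [S.sum_mul_weakLoad_sub, S.sum_mul_weakLoad_sub, ← Finset.sum_add_distrib]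
    refine Finset.sum_congr rfl fun u _ => ?_
    rw [← S.sum_mul_weakLoad_add]
    ring
  have hle : ∀ u ∈ Finset.univ, 2 * (xS z (inc S.E u) * xS x (inc S.E u)) -
      (xS z (inc S.E u) + xS x (inc S.E u)) ≤ 0 := by
    intro u _
    have h1 := hx.2.1 u
    have h2 := hz.2.1 u
    have h3 := S.xS_nonneg hx.1 (inc S.E u)
    have h4 := S.xS_nonneg hz.1 (inc S.E u)
    nlinarith
  have hsum_le := Finset.sum_nonpos hle
  refine ⟨fun e he hze => ?_, fun u => ?_⟩
  · have h0 := (Finset.sum_eq_zero_iff_of_nonneg (nonneg x z hx hz)).1 (by linarith) e he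
    have := (mul_eq_zero.1 h0).resolve_left hze.ne'
    linarith
  · have := (Finset.sum_eq_zero_iff_of_nonpos hle).1 (by linarith) u (Finset.mem_univ u)
    linarith

lemma xS_inc_eq_one {x z : Sym2 V → ℝ} (hx : S.memP x) (hz : S.memP z) {v : V} {e : Sym2 V}
    (he : e ∈ inc S.E v) (hze : 0 < z e) : xS x (inc S.E v) = 1 := by
  have h := (S.tight_of_memP hx hz).2 v
  have hpos : 0 < xS z (inc S.E v) :=
    hze.trans_le (Finset.single_le_sum (fun f _ => hz.1.1 f) he)
  have h1 := hx.2.1 v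
  have h2 := hz.2.1 v
  have h3 := S.xS_nonneg hx.1 (inc S.E v)
  nlinarith

lemma xS_eq_zero_iff {x : Sym2 V → ℝ} (hx : S.IsVec x) {W : Finset (Sym2 V)} :
    xS x W = 0 ↔ ∀ e ∈ W, ¬ 0 < x e := by
  rw [xS, Finset.sum_eq_zero_iff_of_nonneg fun e _ => hx.1 e]
  exact forall₂_congr fun e _ => ⟨fun h => by simp [h], fun h => le_antisymm (not_lt.1 h) (hx.1 e)⟩

lemma xS_succSet_eq_iff {x : Sym2 V → ℝ} (hx : S.IsVec x) (v : V) (e : Sym2 V) :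
    xS x (S.succSet v e) = xS x (inc S.E v) ↔
      ∀ f ∈ inc (S.supp x) v, S.SPref v (some f) (some e) := by
  classical
  have hsplit := Finset.sum_filter_add_sum_filter_not (inc S.E v)
    (fun f => S.SPref v (some f) (some e)) x
  have hrest : xS x (S.succSet v e) = xS x (inc S.E v) ↔
      xS x ((inc S.E v).filter fun f => ¬ S.SPref v (some f) (some e)) = 0 := by
    have : S.succSet v e = (inc S.E v).filter fun f => S.SPref v (some f) (some e) := by
      simp only [succSet]
    rw [this]
    simp only [xS]
    constructor <;> intro h <;> linarith
  rw [hrest, S.xS_eq_zero_iff hx]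
  simp only [supp, mem_inc_iff, Finset.mem_filter]
  grind

lemma xS_simSet_succSet_eq_zero_iff {x : Sym2 V → ℝ} (hx : S.IsVec x) {v : V} {e : Sym2 V}
    (he : e ∈ inc S.E v) :
    (xS x (S.simSet v e) = 0 ∧ xS x (S.succSet v e) = 0) ↔
      ∀ f ∈ inc (S.supp x) v, S.SPref v (some e) (some f) := by
  rw [S.xS_eq_zero_iff hx, S.xS_eq_zero_iff hx]
  have htot := fun f (hf : f ∈ inc S.E v) => S.pref_or he hf
  simp only [simSet, succSet, supp, mem_inc_iff, Finset.mem_filter] at htot ⊢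
  simp only [IPref, SPref]
  grind

end RSetup

open RSetup in
/-- (A1) of Lemma 9: for `x ∈ P` and an edge `e = {v, w} ∈ E⁺`,
`W_x(v) ≻ᵥ e` iff `e ≻_w B_x(w)`. -/
theorem Wset_succ_iff_succ_Bset
    {V : Type*} [Fintype V] [DecidableEq V] (S : RSetup V)
    (hP : ∃ y : Sym2 V → ℝ, S.memP y)
    (x : Sym2 V → ℝ) (hx : S.memP x)
    (v w : V) (he : s(v, w) ∈ S.Eplus) :
    (∀ f ∈ S.Wset x v, S.SPref v (some f) (some s(v, w))) ↔
      (∀ g ∈ S.Bset x w, S.SPref w (some s(v, w)) (some g)) := by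
  obtain ⟨heE, z, hz, hze⟩ : s(v, w) ∈ S.E ∧ ∃ z, S.memP z ∧ 0 < z s(v, w) := by
    simpa [Eplus] using he
  have hev : s(v, w) ∈ inc S.E v := mem_inc_iff.2 ⟨heE, by simp⟩
  have hew : s(v, w) ∈ inc S.E w := mem_inc_iff.2 ⟨heE, by simp⟩
  rw [S.forall_Wset_SPref_iff hev, S.forall_SPref_Bset_iff hew, ← S.xS_succSet_eq_iff hx.1,
    ← S.xS_simSet_succSet_eq_zero_iff hx.1 hew, S.xS_inc_eq_one hx hz hev hze]
  have htight := (S.tight_of_memP hx hz).1 _ heE hze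
  rw [S.sum_endpoints heE] at htight
  simp only [weakLoad] at htight
  have h1 := hx.2.2.1 v w heE
  have h2 := hx.2.2.1.swap heE
  have h3 := S.xS_nonneg hx.1 (S.simSet w s(v, w))
  have h4 := S.xS_nonneg hx.1 (S.succSet w s(v, w))
  constructor
  · intro h
    constructor <;> linarith
  · rintro ⟨h, h'⟩
    linarith
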